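/- Let u be a smooth solution of -Δu = ρu on an annulus {R₀ ≤ |(x,y)| ≤ R₁} ⊂ ℝ², with Fourier coefficients u_k(r) := ∫_0^{2π} u(r,θ)e^{-ikθ}dθ in polar coordinates. If u and all its derivatives are bounded on the annulus uniformly in k, then for each R ∈ (R₀, R₁) there exist δ > 0 and C > 0 such that |u_k(R)| + |u_k'(R)| ≤ C e^{-δ|k|} for all k ∈ ℤ. -/

import Mathlib

open MeasureTheory intervalIntegral

/-- The unnormalized `k`-th Fourier coefficient of a function on `[0, 2π]`. -/
noncomputable def fourierMode (k : ℤ) (F : ℝ → ℂ) : ℂ :=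
  ∫ θ in (0:ℝ)..(2 * Real.pi), F θ * Complex.exp (-Complex.I * k * θ)

theorem norm_exp_neg_I_mul (k : ℤ) (θ : ℝ) : ‖Complex.exp (-Complex.I * k * θ)‖ = 1 := by
  have : -Complex.I * k * θ = ((-k * θ : ℝ) : ℂ) * Complex.I := by push_cast; ring
  rw [this, Complex.norm_exp_ofReal_mul_I]

theorem norm_fourierMode_le (k : ℤ) {F : ℝ → ℂ} {M : ℝ} (hF : ∀ θ, ‖F θ‖ ≤ M) :
    ‖fourierMode k F‖ ≤ M * (2 * Real.pi) := by
  have h := intervalIntegral.norm_integral_le_of_norm_le_const (a := 0) (b := 2 * Real.pi)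
    (C := M) (f := fun θ : ℝ => F θ * Complex.exp (-Complex.I * k * θ)) fun θ _ => by
      rw [norm_mul, norm_exp_neg_I_mul, mul_one]; exact hF θ
  rwa [sub_zero, abs_of_pos Real.two_pi_pos] at h

/-- Taking a Fourier coefficient commutes with differentiation in a parameter. -/
theorem hasDerivAt_fourierMode (k : ℤ) {F F' : ℝ → ℝ → ℂ}
    (hF : Continuous fun p : ℝ × ℝ => F p.1 p.2)
    (hF' : Continuous fun p : ℝ × ℝ => F' p.1 p.2)
    (hd : ∀ r θ, HasDerivAt (fun s => F s θ) (F' r θ) r) (r : ℝ) :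
    HasDerivAt (fun s => fourierMode k (F s)) (fourierMode k (F' r)) r := by
  obtain ⟨C, hC⟩ := ((isCompact_Icc (a := r - 1) (b := r + 1)).prod
    (isCompact_Icc (a := 0) (b := 2 * Real.pi))).exists_bound_of_continuousOn hF'.continuousOn
  have cont (G : ℝ → ℝ → ℂ) (hG : Continuous fun p : ℝ × ℝ => G p.1 p.2) (s : ℝ) :
      Continuous fun θ : ℝ => G s θ * Complex.exp (-Complex.I * k * θ) := by
    have : Continuous fun θ : ℝ => G s θ := hG.comp (by fun_prop : Continuous fun θ => (s, θ))
    fun_prop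
  refine (intervalIntegral.hasDerivAt_integral_of_dominated_loc_of_deriv_le
    (F := fun s θ => F s θ * Complex.exp (-Complex.I * k * θ))
    (F' := fun s θ => F' s θ * Complex.exp (-Complex.I * k * θ)) (bound := fun _ => C)
    (s := Set.Icc (r - 1) (r + 1)) (Icc_mem_nhds (by linarith) (by linarith))
    (.of_forall fun s => (cont F hF s).aestronglyMeasurable)
    ((cont F hF r).intervalIntegrable _ _) (cont F' hF' r).aestronglyMeasurable
    (.of_forall fun θ hθ s hs => ?_) intervalIntegrable_const
    (.of_forall fun θ _ s _ => (hd s θ).mul_const _)).2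
  rw [norm_mul, norm_exp_neg_I_mul, mul_one]
  rw [Set.uIoc_of_le Real.two_pi_pos.le] at hθ
  exact hC (s, θ) ⟨hs, hθ.1.le, hθ.2⟩

/-- Fourier coefficients turn differentiation of periodic functions into multiplication. -/
theorem fourierMode_deriv (k : ℤ) {F F' : ℝ → ℂ} (hd : ∀ θ, HasDerivAt F (F' θ) θ)
    (hF' : Continuous F') (hper : F (2 * Real.pi) = F 0) :
    fourierMode k F' = Complex.I * k * fourierMode k F := by
  have he (θ : ℝ) : HasDerivAt (fun θ : ℝ => Complex.exp (-Complex.I * k * θ))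
      (Complex.exp (-Complex.I * k * θ) * (-Complex.I * k)) θ := by
    simpa using ((Complex.ofRealCLM.hasDerivAt (x := θ)).const_mul (-Complex.I * k)).cexp
  have hF : Continuous F := continuous_iff_continuousAt.2 fun θ => (hd θ).continuousAt
  have h := intervalIntegral.integral_deriv_mul_eq_sub (a := 0) (b := 2 * Real.pi)
    (fun θ _ => hd θ) (fun θ _ => he θ) (hF'.intervalIntegrable _ _)
    ((by fun_prop : Continuous fun θ : ℝ =>
      Complex.exp (-Complex.I * k * θ) * (-Complex.I * k)).intervalIntegrable _ _)
  have e1 : Complex.exp (-Complex.I * k * ((2 * Real.pi : ℝ) : ℂ)) = 1 := by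
    rw [Complex.exp_eq_one_iff]
    exact ⟨-k, by push_cast; ring⟩
  rw [intervalIntegral.integral_add
    ((by fun_prop : Continuous fun θ : ℝ =>
      F' θ * Complex.exp (-Complex.I * k * θ)).intervalIntegrable _ _)
    ((by fun_prop : Continuous fun θ : ℝ =>
      F θ * (Complex.exp (-Complex.I * k * θ) * (-Complex.I * k))).intervalIntegrable _ _),
    hper, e1] at h
  simp only [← mul_assoc, intervalIntegral.integral_mul_const] at h
  simp only [Complex.ofReal_zero, mul_zero, Complex.exp_zero, sub_self] at h
  unfold fourierMode
  linear_combination h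

/-- A function with `w'' ≥ a² w` is exponentially small away from the endpoints. -/
theorem two_mul_le_of_sq_mul_le_deriv2 {a x y : ℝ} {w w₁ w₂ : ℝ → ℝ}
    (h₁ : ∀ r ∈ Set.Icc x y, HasDerivAt w (w₁ r) r)
    (h₂ : ∀ r ∈ Set.Icc x y, HasDerivAt w₁ (w₂ r) r)
    (hw : ∀ r ∈ Set.Icc x y, a ^ 2 * w r ≤ w₂ r) {r : ℝ} (hr : r ∈ Set.Icc x y) :
    2 * a * w r ≤ (a * w y + w₁ y) * Real.exp (-(a * (y - r))) +
      (a * w x - w₁ x) * Real.exp (-(a * (r - x))) := by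
  have he (c s : ℝ) : HasDerivAt (fun s => Real.exp (c * s)) (Real.exp (c * s) * c) s := by
    simpa using ((hasDerivAt_id s).const_mul c).exp
  have hg (s) (hs : s ∈ Set.Icc x y) := ((h₁ s hs).const_mul a |>.add (h₂ s hs)).mul (he (-a) s)
  have hh (s) (hs : s ∈ Set.Icc x y) := ((h₂ s hs).sub ((h₁ s hs).const_mul a)).mul (he a s)
  have mg := monotoneOn_of_hasDerivWithinAt_nonneg (convex_Icc x y)
    (fun s hs => (hg s hs).continuousAt.continuousWithinAt)
    (fun s hs => (hg s (interior_subset hs)).hasDerivWithinAt) (fun s hs => by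
      have := hw s (interior_subset hs)
      have := Real.exp_pos (-a * s)
      simp only [Pi.add_apply]
      nlinarith)
  have mh := monotoneOn_of_hasDerivWithinAt_nonneg (convex_Icc x y)
    (fun s hs => (hh s hs).continuousAt.continuousWithinAt)
    (fun s hs => (hh s (interior_subset hs)).hasDerivWithinAt) (fun s hs => by
      have := hw s (interior_subset hs)
      have := Real.exp_pos (a * s)
      simp only [Pi.sub_apply]
      nlinarith)
  have hxy := hr.1.trans hr.2
  have A := mul_le_mul_of_nonneg_right (mg hr ⟨hxy, le_rfl⟩ hr.2) (Real.exp_pos (a * r)).le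
  have B := mul_le_mul_of_nonneg_right (mh ⟨le_rfl, hxy⟩ hr hr.1) (Real.exp_pos (-a * r)).le
  simp only [Pi.mul_apply, Pi.add_apply, Pi.sub_apply, mul_assoc, ← Real.exp_add] at A B
  rw [show -a * r + a * r = 0 by ring, show -a * y + a * r = -(a * (y - r)) by ring] at A
  rw [show a * r + -a * r = 0 by ring, show a * x + -a * r = -(a * (r - x)) by ring] at B
  simp only [Real.exp_zero, mul_one] at A B
  linarith

/-- Agmon estimate for the radial Helmholtz equation in the elliptic regime. -/
theorem norm_sq_le_of_radial_helmholtz {R₀ R₁ a M κ : ℝ} {ρ : ℂ} {v v₁ v₂ : ℝ → ℂ}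
    (hR₀ : 0 < R₀) (ha : 1 ≤ a)
    (hκ : a ^ 2 + 2 * ‖ρ‖ + 1 / (2 * R₀ ^ 2) ≤ 2 * κ ^ 2 / R₁ ^ 2)
    (h₁ : ∀ r ∈ Set.Icc R₀ R₁, HasDerivAt v (v₁ r) r)
    (h₂ : ∀ r ∈ Set.Icc R₀ R₁, HasDerivAt v₁ (v₂ r) r)
    (hode : ∀ r ∈ Set.Icc R₀ R₁,
      v₂ r = ((-(1 / r) : ℝ) : ℂ) * v₁ r + ((κ ^ 2 / r ^ 2 : ℝ) : ℂ) * v r - ρ * v r)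
    (hM : ∀ r ∈ Set.Icc R₀ R₁, ‖v r‖ ≤ M) (hM₁ : ∀ r ∈ Set.Icc R₀ R₁, ‖v₁ r‖ ≤ M)
    {η r : ℝ} (hr : r ∈ Set.Icc (R₀ + η) (R₁ - η)) (hη : 0 ≤ η) :
    ‖v r‖ ^ 2 ≤ 3 * M ^ 2 * Real.exp (-(a * η)) := by
  have hw (s) (hs : s ∈ Set.Icc R₀ R₁) : a ^ 2 * ‖v s‖ ^ 2 ≤
      2 * (inner ℝ (v s) (v₂ s) + inner ℝ (v₁ s) (v₁ s)) := by
    have hs0 : 0 < s := hR₀.trans_le hs.1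
    rw [hode s hs, inner_sub_right, inner_add_right, real_inner_self_eq_norm_sq,
      ← Complex.real_smul, ← Complex.real_smul, inner_smul_right, inner_smul_right,
      real_inner_self_eq_norm_sq]
    have i1 : inner ℝ (v s) (v₁ s) ≤ ‖v s‖ * ‖v₁ s‖ := real_inner_le_norm _ _
    have i2 : inner ℝ (v s) (ρ * v s) ≤ ‖ρ‖ * ‖v s‖ ^ 2 :=
      (real_inner_le_norm _ _).trans_eq (by rw [norm_mul]; ring)
    have i3 : 1 / s * inner ℝ (v s) (v₁ s) ≤ 1 / s * (‖v s‖ * ‖v₁ s‖) := by gcongr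
    have i4 : 1 / (2 * s ^ 2) ≤ 1 / (2 * R₀ ^ 2) := by gcongr; exact hs.1
    have i5 : 2 * κ ^ 2 / R₁ ^ 2 ≤ 2 * κ ^ 2 / s ^ 2 := by gcongr; exact hs.2
    have i6 : 2 * (1 / s * (‖v s‖ * ‖v₁ s‖)) ≤ 2 * ‖v₁ s‖ ^ 2 + 1 / (2 * s ^ 2) * ‖v s‖ ^ 2 := by
      have : 2 * ‖v₁ s‖ ^ 2 + 1 / (2 * s ^ 2) * ‖v s‖ ^ 2 - 2 * (1 / s * (‖v s‖ * ‖v₁ s‖)) =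
        2 * (‖v₁ s‖ - ‖v s‖ / (2 * s)) ^ 2 := by field_simp; ring
      nlinarith [sq_nonneg (‖v₁ s‖ - ‖v s‖ / (2 * s))]
    have i7 : (a ^ 2 + 2 * ‖ρ‖ + 1 / (2 * s ^ 2)) * ‖v s‖ ^ 2 ≤
        2 * κ ^ 2 / s ^ 2 * ‖v s‖ ^ 2 := by gcongr; linarith
    have i8 : 2 * κ ^ 2 / s ^ 2 * ‖v s‖ ^ 2 = 2 * (κ ^ 2 / s ^ 2 * ‖v s‖ ^ 2) := by ring
    nlinarith
  have hr' : r ∈ Set.Icc R₀ R₁ := ⟨by linarith [hr.1], by linarith [hr.2]⟩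
  have key := two_mul_le_of_sq_mul_le_deriv2 (a := a) (fun s hs => (h₁ s hs).norm_sq)
    (fun s hs => ((h₁ s hs).inner ℝ (h₂ s hs)).const_mul 2) hw hr'
  have bound (s) (hs : s ∈ Set.Icc R₀ R₁) : |2 * inner ℝ (v s) (v₁ s)| ≤ 2 * M ^ 2 ∧
      ‖v s‖ ^ 2 ≤ M ^ 2 := by
    have h0 := hM s hs
    have h1 := hM₁ s hs
    have h2 : 0 ≤ M := (norm_nonneg _).trans h0
    refine ⟨?_, by gcongr⟩
    rw [abs_mul, abs_two, sq]
    gcongr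
    exact (abs_real_inner_le_norm _ _).trans (by gcongr)
  have hRR := hr'.1.trans hr'.2
  obtain ⟨b1, b2⟩ := bound R₁ ⟨hRR, le_rfl⟩
  obtain ⟨b3, b4⟩ := bound R₀ ⟨le_rfl, hRR⟩
  have e1 : Real.exp (-(a * (R₁ - r))) ≤ Real.exp (-(a * η)) := by
    gcongr; linarith [hr.2]
  have e2 : Real.exp (-(a * (r - R₀))) ≤ Real.exp (-(a * η)) := by
    gcongr; linarith [hr.1]
  have c1 : a * ‖v R₁‖ ^ 2 + 2 * inner ℝ (v R₁) (v₁ R₁) ≤ 3 * a * M ^ 2 := by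
    nlinarith [le_abs_self (2 * inner ℝ (v R₁) (v₁ R₁)), sq_nonneg M]
  have c2 : a * ‖v R₀‖ ^ 2 - 2 * inner ℝ (v R₀) (v₁ R₀) ≤ 3 * a * M ^ 2 := by
    nlinarith [neg_abs_le (2 * inner ℝ (v R₀) (v₁ R₀)), sq_nonneg M]
  have c0 : 0 ≤ 3 * a * M ^ 2 := by positivity
  have d1 := mul_le_mul c1 e1 (Real.exp_pos _).le c0
  have d2 := mul_le_mul c2 e2 (Real.exp_pos _).le c0
  refine le_of_mul_le_mul_left ?_ (by linarith : 0 < 2 * a)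
  linarith

/-- A Landau-type bound of a derivative by the function and its second derivative. -/
theorem norm_deriv_le_of_norm_le {x h A B : ℝ} {v v₁ v₂ : ℝ → ℂ} (hh : 0 < h)
    (h₁ : ∀ r ∈ Set.Icc x (x + h), HasDerivAt v (v₁ r) r)
    (h₂ : ∀ r ∈ Set.Icc x (x + h), HasDerivAt v₁ (v₂ r) r)
    (hA : ∀ r ∈ Set.Icc x (x + h), ‖v r‖ ≤ A) (hB : ∀ r ∈ Set.Icc x (x + h), ‖v₂ r‖ ≤ B) :
    ‖v₁ x‖ ≤ 2 * A / h + B * h := by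
  have hx : x ∈ Set.Icc x (x + h) := ⟨le_rfl, by linarith⟩
  have hy : x + h ∈ Set.Icc x (x + h) := ⟨by linarith, le_rfl⟩
  have hB0 : 0 ≤ B := (norm_nonneg _).trans (hB x hx)
  have d (r) (hr : r ∈ Set.Icc x (x + h)) : ‖v₁ r - v₁ x‖ ≤ B * h := by
    refine ((convex_Icc x (x + h)).norm_image_sub_le_of_norm_hasDerivWithin_le
      (fun s hs => (h₂ s hs).hasDerivWithinAt) hB hx hr).trans ?_
    gcongr
    rw [Real.norm_eq_abs, abs_of_nonneg (by linarith [hr.1])]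
    linarith [hr.2]
  have t := (convex_Icc x (x + h)).norm_image_sub_le_of_norm_hasDerivWithin_le
    (f := fun s => v s - s • v₁ x) (f' := fun s => v₁ s - (1 : ℝ) • v₁ x)
    (fun s hs => ((h₁ s hs).sub ((hasDerivAt_id s).smul_const _)).hasDerivWithinAt)
    (fun s hs => by simpa using d s hs) hx hy
  rw [add_sub_cancel_left, Real.norm_eq_abs, abs_of_pos hh] at t
  have e : h • v₁ x = v (x + h) - v x -
      (v (x + h) - (x + h) • v₁ x - (v x - x • v₁ x)) := by
    rw [add_smul]; abel
  have n : h * ‖v₁ x‖ ≤ A + A + B * h * h := by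
    rw [← abs_of_pos hh, ← Real.norm_eq_abs, ← norm_smul, Real.norm_eq_abs, abs_of_pos hh, e]
    exact (norm_sub_le _ _).trans <| add_le_add
      ((norm_sub_le _ _).trans <| add_le_add (hA _ hy) (hA _ hx)) t
  rw [← sub_le_iff_le_add, le_div_iff₀ hh]
  linarith

theorem ContDiff.deriv_fst {u : ℝ → ℝ → ℂ}
    (hu : ContDiff ℝ (⊤ : ℕ∞) (fun p : ℝ × ℝ => u p.1 p.2)) :
    ContDiff ℝ (⊤ : ℕ∞) (fun p : ℝ × ℝ => deriv (fun s => u s p.2) p.1) := by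
  have h : ContDiff ℝ (⊤ : ℕ∞) (Function.uncurry fun (p : ℝ × ℝ) (s : ℝ) => u s p.2) :=
    hu.comp (by fun_prop : ContDiff ℝ (⊤ : ℕ∞) fun q : (ℝ × ℝ) × ℝ => (q.2, q.1.2))
  exact (h.fderiv (n := (⊤ : ℕ∞)) contDiff_fst (by simp)).clm_apply contDiff_const

theorem ContDiff.hasDerivAt_fst {u : ℝ → ℝ → ℂ}
    (hu : ContDiff ℝ (⊤ : ℕ∞) (fun p : ℝ × ℝ => u p.1 p.2)) (r θ : ℝ) :
    HasDerivAt (fun s => u s θ) (deriv (fun s => u s θ) r) r := by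
  have h : ContDiff ℝ (⊤ : ℕ∞) fun s => u s θ :=
    hu.comp (by fun_prop : ContDiff ℝ (⊤ : ℕ∞) fun s : ℝ => (s, θ))
  exact (h.differentiable (by simp) r).hasDerivAt

/-- Two derivatives of a smooth periodic function multiply its Fourier coefficient by `-k²`. -/
theorem fourierMode_deriv_deriv (k : ℤ) {F : ℝ → ℂ} (hF : ContDiff ℝ (⊤ : ℕ∞) F)
    (hper : ∀ θ, F (θ + 2 * Real.pi) = F θ) :
    fourierMode k (deriv (deriv F)) = -(k : ℂ) ^ 2 * fourierMode k F := by
  have hF1 : ContDiff ℝ (⊤ : ℕ∞) (deriv F) := (contDiff_infty_iff_deriv.1 hF).2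
  have hF2 : ContDiff ℝ (⊤ : ℕ∞) (deriv (deriv F)) := (contDiff_infty_iff_deriv.1 hF1).2
  have p1 : deriv F (2 * Real.pi) = deriv F 0 := by
    have := deriv_comp_add_const F (2 * Real.pi) 0
    rw [zero_add] at this
    rw [← this]
    exact congrArg (fun G => deriv G 0) (funext hper)
  rw [fourierMode_deriv k (fun θ => (hF1.differentiable (by simp) θ).hasDerivAt) hF2.continuous p1,
    fourierMode_deriv k (fun θ => (hF.differentiable (by simp) θ).hasDerivAt) hF1.continuous
      (by simpa using hper 0)]
  linear_combination (k : ℂ) ^ 2 * fourierMode k F * Complex.I_sq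

/-- The Fourier coefficients of a Helmholtz solution solve the radial equation. -/
theorem fourierMode_radial_helmholtz {ρ : ℂ} {u : ℝ → ℝ → ℂ} {r : ℝ}
    (hu : ContDiff ℝ (⊤ : ℕ∞) (fun p : ℝ × ℝ => u p.1 p.2))
    (hper : ∀ θ, u r (θ + 2 * Real.pi) = u r θ)
    (heq : ∀ θ : ℝ,
      -(deriv (deriv (fun s => u s θ)) r) - (1 / r) * deriv (fun s => u s θ) r -
          (1 / r ^ 2) * deriv (deriv (fun t => u r t)) θ = ρ * u r θ) (k : ℤ) :
    fourierMode k (fun θ => deriv (deriv (fun s => u s θ)) r) =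
      ((-(1 / r) : ℝ) : ℂ) * fourierMode k (fun θ => deriv (fun s => u s θ) r) +
      (((k : ℝ) ^ 2 / r ^ 2 : ℝ) : ℂ) * fourierMode k (u r) - ρ * fourierMode k (u r) := by
  have slice {G : ℝ → ℝ → ℂ} (hG : ContDiff ℝ (⊤ : ℕ∞) (fun p : ℝ × ℝ => G p.1 p.2)) :
      ContDiff ℝ (⊤ : ℕ∞) (G r) :=
    hG.comp (by fun_prop : ContDiff ℝ (⊤ : ℕ∞) fun θ : ℝ => (r, θ))
  have c0 := slice hu
  have c1 : Continuous fun θ => deriv (fun s => u s θ) r :=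
    (slice (G := fun r θ => deriv (fun s => u s θ) r) hu.deriv_fst).continuous
  have c2 : Continuous (deriv (deriv (u r))) :=
    (contDiff_infty_iff_deriv.1 (contDiff_infty_iff_deriv.1 c0).2).2.continuous
  have hint {G : ℝ → ℂ} (hG : Continuous G) (c : ℂ) : IntervalIntegrable
      (fun θ : ℝ => c * (G θ * Complex.exp (-Complex.I * k * θ))) volume 0 (2 * Real.pi) :=
    (by fun_prop : Continuous fun θ : ℝ =>
      c * (G θ * Complex.exp (-Complex.I * k * θ))).intervalIntegrable _ _
  have h := fourierMode_deriv_deriv k c0 hper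
  have e : fourierMode k (fun θ => deriv (deriv (fun s => u s θ)) r) =
      -(1 / r) * fourierMode k (fun θ => deriv (fun s => u s θ) r) +
      -(1 / r ^ 2) * fourierMode k (deriv (deriv (u r))) + -ρ * fourierMode k (u r) := by
    unfold fourierMode
    rw [← intervalIntegral.integral_const_mul, ← intervalIntegral.integral_const_mul,
      ← intervalIntegral.integral_const_mul,
      ← intervalIntegral.integral_add (hint c1 _) (hint c2 _),
      ← intervalIntegral.integral_add ((hint c1 _).add (hint c2 _)) (hint c0.continuous _)]
    refine intervalIntegral.integral_congr fun θ _ => ?_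
    linear_combination -Complex.exp (-Complex.I * k * θ) * heq θ
  rw [e, h]
  push_cast
  ring

/-- Agmon-type decay of Fourier modes: if `u(r,θ)` (a smooth solution of `-Δu = ρu` in
polar coordinates on the annulus `R₀ ≤ r ≤ R₁`, `2π`-periodic in `θ`) is bounded together
with all its derivatives, then for each `R ∈ (R₀,R₁)` the Fourier coefficients
`u_k(r) = ∫_0^{2π} u(r,θ)e^{-ikθ}dθ` satisfy `|u_k(R)| + |u_k'(R)| ≤ C e^{-δ|k|}`. -/
theorem stmt_9 (R₀ R₁ : ℝ) (hR₀ : 0 < R₀) (hRR : R₀ < R₁)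
    (ρ : ℂ) (u : ℝ → ℝ → ℂ)
    (hsmooth : ContDiff ℝ (⊤ : ℕ∞) (fun p : ℝ × ℝ => u p.1 p.2))
    (hper : ∀ r θ, u r (θ + 2 * Real.pi) = u r θ)
    (heq : ∀ r ∈ Set.Icc R₀ R₁, ∀ θ : ℝ,
      -(deriv (deriv (fun s => u s θ)) r) - (1 / r) * deriv (fun s => u s θ) r -
          (1 / r ^ 2) * deriv (deriv (fun t => u r t)) θ = ρ * u r θ)
    (hbound : ∀ m n : ℕ, ∃ M : ℝ, ∀ r ∈ Set.Icc R₀ R₁, ∀ θ : ℝ,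
      ‖iteratedDeriv n (fun t => iteratedDeriv m (fun s => u s t) r) θ‖ ≤ M) :
    ∀ R ∈ Set.Ioo R₀ R₁, ∃ δ > 0, ∃ C > 0, ∀ k : ℤ,
      ‖∫ θ in (0:ℝ)..(2 * Real.pi), u R θ * Complex.exp (-Complex.I * k * θ)‖ +
          ‖deriv (fun r => ∫ θ in (0:ℝ)..(2 * Real.pi),
              u r θ * Complex.exp (-Complex.I * k * θ)) R‖ ≤
        C * Real.exp (-δ * |(k : ℝ)|) := by
  intro R hR
  obtain ⟨M₀, hM₀⟩ := hbound 0 0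
  obtain ⟨M₁, hM₁⟩ := hbound 1 0
  obtain ⟨M₂, hM₂⟩ := hbound 2 0
  simp only [iteratedDeriv_zero, iteratedDeriv_succ] at hM₀ hM₁ hM₂
  have hu₁ := hsmooth.deriv_fst
  have hu₂ := ContDiff.deriv_fst (u := fun r θ => deriv (fun s => u s θ) r) hu₁
  set v : ℤ → ℝ → ℂ := fun k r => fourierMode k (u r)
  set v₁ : ℤ → ℝ → ℂ := fun k r => fourierMode k (fun θ => deriv (fun s => u s θ) r)
  set v₂ : ℤ → ℝ → ℂ := fun k r => fourierMode k (fun θ => deriv (deriv (fun s => u s θ)) r)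
  have d₁ (k r) : HasDerivAt (v k) (v₁ k r) r := hasDerivAt_fourierMode k hsmooth.continuous
    hu₁.continuous hsmooth.hasDerivAt_fst r
  have d₂ (k r) : HasDerivAt (v₁ k) (v₂ k r) r := hasDerivAt_fourierMode k
    (F := fun r θ => deriv (fun s => u s θ) r) hu₁.continuous hu₂.continuous
    (ContDiff.hasDerivAt_fst (u := fun r θ => deriv (fun s => u s θ) r) hu₁) r
  obtain ⟨M, hM1, hMv, hMv₁, hMv₂⟩ : ∃ M : ℝ, 0 < M ∧
      (∀ k, ∀ r ∈ Set.Icc R₀ R₁, ‖v k r‖ ≤ M) ∧ (∀ k, ∀ r ∈ Set.Icc R₀ R₁, ‖v₁ k r‖ ≤ M) ∧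
      (∀ k, ∀ r ∈ Set.Icc R₀ R₁, ‖v₂ k r‖ ≤ M) := by
    have le {a : ℝ} (ha : a ≤ |M₀| + |M₁| + |M₂| + 1) :
      a * (2 * Real.pi) ≤ (|M₀| + |M₁| + |M₂| + 1) * (2 * Real.pi) := by gcongr
    refine ⟨(|M₀| + |M₁| + |M₂| + 1) * (2 * Real.pi), by positivity,
      fun k r hr => (norm_fourierMode_le k (hM₀ r hr)).trans (le ?_),
      fun k r hr => (norm_fourierMode_le k (hM₁ r hr)).trans (le ?_),
      fun k r hr => (norm_fourierMode_le k (hM₂ r hr)).trans (le ?_)⟩ <;>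
    linarith [le_abs_self M₀, le_abs_self M₁, le_abs_self M₂, abs_nonneg M₀, abs_nonneg M₁,
      abs_nonneg M₂]
  have hR₁ : 0 < R₁ := hR₀.trans hRR
  have hderiv (k : ℤ) : deriv (fun r => ∫ θ in (0:ℝ)..(2 * Real.pi),
      u r θ * Complex.exp (-Complex.I * k * θ)) R = v₁ k R := (d₁ k R).deriv
  obtain ⟨η, hη, hη₀, hη₁⟩ : ∃ η > 0, R₀ + η ≤ R ∧ R + η ≤ R₁ - η := by
    refine ⟨min (R - R₀) ((R₁ - R) / 2), lt_min (by linarith [hR.1]) (by linarith [hR.2]), ?_, ?_⟩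
    · linarith [min_le_left (R - R₀) ((R₁ - R) / 2)]
    · linarith [min_le_right (R - R₀) ((R₁ - R) / 2)]
  set K : ℝ := R₁ * (1 + 2 * ‖ρ‖ + 1 / (2 * R₀ ^ 2)) with hK
  set δ : ℝ := η / (4 * R₁) with hδ
  have hδ0 : 0 < δ := by positivity
  refine ⟨δ, hδ0, 2 * M * Real.exp (δ * K) + (2 * M + 4 * M / η + M * η), by positivity,
    fun k => ?_⟩
  rw [hderiv]
  change ‖v k R‖ + ‖v₁ k R‖ ≤ _
  have hRI : R ∈ Set.Icc R₀ R₁ := ⟨hR.1.le, hR.2.le⟩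
  rw [add_mul]
  rcases le_total |(k : ℝ)| K with hk | hk
  · have h1 : 2 * M ≤ 2 * M * Real.exp (δ * K) * Real.exp (-δ * |(k : ℝ)|) := by
      rw [mul_assoc, ← Real.exp_add]
      refine le_mul_of_one_le_right (by positivity) (Real.one_le_exp ?_)
      nlinarith
    have h2 : 0 ≤ (2 * M + 4 * M / η + M * η) * Real.exp (-δ * |(k : ℝ)|) := by positivity
    linarith [hMv k R hRI, hMv₁ k R hRI]
  · set a : ℝ := |(k : ℝ)| / R₁ with ha
    have haK : 1 + 2 * ‖ρ‖ + 1 / (2 * R₀ ^ 2) ≤ a := by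
      rw [ha, le_div_iff₀ hR₁]; linarith
    have hq : 0 ≤ 2 * ‖ρ‖ + 1 / (2 * R₀ ^ 2) := by positivity
    have ha1 : 1 ≤ a := by linarith
    have hκ : a ^ 2 + 2 * ‖ρ‖ + 1 / (2 * R₀ ^ 2) ≤ 2 * (k : ℝ) ^ 2 / R₁ ^ 2 := by
      have : 2 * (k : ℝ) ^ 2 / R₁ ^ 2 = 2 * a ^ 2 := by
        rw [ha, div_pow, sq_abs]; ring
      nlinarith
    set E : ℝ := Real.exp (-δ * |(k : ℝ)|) with hE
    have hE0 : 0 < E := Real.exp_pos _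
    have hE1 : E ≤ 1 := Real.exp_le_one_iff.2 (by nlinarith [abs_nonneg (k : ℝ)])
    have hexp : Real.exp (-(a * η)) = (E ^ 2) ^ 2 := by
      rw [hE, ← pow_mul, ← Real.exp_nat_mul]
      congr 1
      rw [ha, hδ]; push_cast; field_simp
    have hsmall (r) (hr : r ∈ Set.Icc R (R + η)) : ‖v k r‖ ≤ 2 * M * E ^ 2 := by
      have := norm_sq_le_of_radial_helmholtz hR₀ ha1 hκ (fun r _ => d₁ k r) (fun r _ => d₂ k r)
        (fun r hr => fourierMode_radial_helmholtz hsmooth (hper r) (heq r hr) k)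
        (hMv k) (hMv₁ k) (η := η) (r := r) ⟨by linarith [hr.1], by linarith [hr.2]⟩ hη.le
      rw [hexp] at this
      refine (sq_le_sq₀ (norm_nonneg _) (by positivity)).1 ?_
      nlinarith [sq_nonneg (M * E ^ 2)]
    have hsub {r} (hr : r ∈ Set.Icc R (R + η * E)) : r ∈ Set.Icc R (R + η) :=
      ⟨hr.1, hr.2.trans (by nlinarith)⟩
    have hl := norm_deriv_le_of_norm_le (mul_pos hη hE0) (fun r _ => d₁ k r) (fun r _ => d₂ k r)
      (fun r hr => hsmall r (hsub hr)) (fun r hr => hMv₂ k r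
        ⟨by linarith [(hsub hr).1, hR.1], by linarith [(hsub hr).2]⟩)
    have hs := hsmall R ⟨le_rfl, by linarith⟩
    have e1 : 2 * (2 * M * E ^ 2) / (η * E) = 4 * M / η * E := by field_simp; ring
    have e2 : 2 * M * E ^ 2 ≤ 2 * M * E := by
      gcongr; nlinarith
    have e3 : 0 ≤ 2 * M * Real.exp (δ * K) * E := by positivity
    rw [e1] at hl
    linarith
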